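/- Let f_ε be the test function built from the specific choices B(x₂) = sin(πx₂) for x₂ ∈ [−1,1], B = 0 outside [−1,1], and A smooth with supp A ⊆ [0,1], ∫A = 0 and ∫₀¹ A(x) h_{[0,1)}(x) dx = ∫₀¹ sin(2πx) h_{[0,1)}(x) dx. Then supp P^{(1,0)}(f_ε) ⊆ [−1,1]×[−1,1] and ‖P^{(1,0)}(f_ε)‖_{L²(ℝ²)} ≥ c ε^{1/2} for a constant c > 0 independent of ε; hence for every p ≥ 2, ‖P^{(1,0)}(f_ε)‖_{L^p(ℝ²)} ≥ c_p ε^{1/2}. -/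

import Mathlib

open MeasureTheory Filter
open scoped ENNReal Topology

noncomputable section

/-- The Haar function on `[0,1)`. -/
def haar0 (x : ℝ) : ℝ :=
  Set.indicator (Set.Ico (0:ℝ) (1/2)) (fun _ => (1:ℝ)) x
    - Set.indicator (Set.Ico (1/2:ℝ) 1) (fun _ => (1:ℝ)) x

/-- A dyadic cube in `ℝ^n`, recorded by the exponent `k` of its side length `2^k`
and the position `pos`; the cube is `∏_t [pos t · 2^k, (pos t + 1) · 2^k)`. -/
abbrev DyadicCube (n : ℕ) := ℤ × (Fin n → ℤ)

/-- The (L∞-normalized) Haar function on the dyadic interval `[i·2^k, (i+1)·2^k)`. -/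
def haarInt (k i : ℤ) (x : ℝ) : ℝ := haar0 ((x - (i : ℝ) * 2 ^ k) / 2 ^ k)

/-- The indicator of the dyadic interval `[i·2^k, (i+1)·2^k)`. -/
def indInt (k i : ℤ) (x : ℝ) : ℝ :=
  Set.indicator (Set.Ico ((i:ℝ) * 2 ^ k) (((i:ℝ)+1) * 2 ^ k)) (fun _ => (1:ℝ)) x

/-- The Haar function `h_Q^{(ε)}` on a dyadic cube `Q` with direction `ε ∈ {0,1}^n`:
the factor in coordinate `t` is `h_{I_t}` if `ε t` and `1_{I_t}` otherwise. -/
def haarCube (n : ℕ) (ε : Fin n → Bool) (Q : DyadicCube n) (x : Fin n → ℝ) : ℝ :=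
  ∏ t, (if ε t then haarInt Q.1 (Q.2 t) (x t) else indInt Q.1 (Q.2 t) (x t))

/-- The volume `|Q| = 2^{kn}` of a dyadic cube. -/
def cubeVol (n : ℕ) (Q : DyadicCube n) : ℝ := 2 ^ (Q.1 * (n:ℤ))

/-- The pointset of a dyadic cube. -/
def cubeSet (n : ℕ) (Q : DyadicCube n) : Set (Fin n → ℝ) :=
  Set.univ.pi fun t => Set.Ico ((Q.2 t : ℝ) * 2 ^ Q.1) (((Q.2 t : ℝ) + 1) * 2 ^ Q.1)

/-- The directional Haar projection `P^{(ε)}`. -/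
def haarProj (n : ℕ) (ε : Fin n → Bool) (u : (Fin n → ℝ) → ℝ) (x : Fin n → ℝ) : ℝ :=
  ∑' Q : DyadicCube n, (∫ y, u y * haarCube n ε Q y) * haarCube n ε Q x / cubeVol n Q

/-- The Fourier transform `ℱu(ξ) = ∫ e^{-i⟨x,ξ⟩} u(x) dx`. -/
def fourierT (n : ℕ) (u : (Fin n → ℝ) → ℂ) (ξ : Fin n → ℝ) : ℂ :=
  ∫ x : Fin n → ℝ, Complex.exp (-(Complex.I) * ((∑ t, x t * ξ t : ℝ) : ℂ)) * u x

/-- The inverse Fourier transform. -/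
def invFourierT (n : ℕ) (v : (Fin n → ℝ) → ℂ) (x : Fin n → ℝ) : ℂ :=
  (((2 * Real.pi) ^ n : ℝ) : ℂ)⁻¹ *
    ∫ ξ : Fin n → ℝ, Complex.exp (Complex.I * ((∑ t, x t * ξ t : ℝ) : ℂ)) * v ξ

/-- The Riesz transform `R_i u = -√-1 ℱ⁻¹((ξ_i/|ξ|) ℱu)`. -/
def riesz (n : ℕ) (i : Fin n) (u : (Fin n → ℝ) → ℝ) (x : Fin n → ℝ) : ℂ :=
  -(Complex.I) * invFourierT n
    (fun ξ => ((ξ i / Real.sqrt (∑ t, ξ t ^ 2) : ℝ) : ℂ) * fourierT n (fun y => ((u y : ℝ) : ℂ)) ξ) x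

/-- The `j`-th standard direction `e_j`. -/
def stdDir (n : ℕ) (j : Fin n) : Fin n → Bool := fun t => decide (t = j)

end
noncomputable section

/-- The rescaled building block `g_Q = s_I ⊗ d_J` on the dyadic square
`Q = [l_I, l_I + 2^{-j}) × [l_J, l_J + 2^{-j})`:
`g_Q(x) = A((x₁ − l_I)·2^j) · B((x₂ − l_J)·2^j / ε)` with `ε = 2^{-n0}`. -/
def gBlock (A B : ℝ → ℝ) (n0 : ℕ) (j : ℕ) (lI lJ : ℝ) (x : Fin 2 → ℝ) : ℝ :=
  A ((x 0 - lI) * 2 ^ j) * B ((x 1 - lJ) * 2 ^ j * 2 ^ n0)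

/-- The test function `f_ε = Σ_{k=1}^{1/ε} Σ_{I ∈ 𝒟_{2kn₀}} Σ_{J ∈ 𝓛_{2kn₀}} g_{I×J}`,
where `ε = 2^{-n0}`, `𝒟_j` are the dyadic subintervals of `[0,1]` of length `2^{-j}`
and `𝓛_j ⊆ 𝒟_j` are the even-numbered ones. -/
def fTest (A B : ℝ → ℝ) (n0 : ℕ) (x : Fin 2 → ℝ) : ℝ :=
  ∑ k ∈ Finset.Icc 1 (2 ^ n0), ∑ i ∈ Finset.range (2 ^ (2 * k * n0)),
    ∑ i' ∈ Finset.range (2 ^ (2 * k * n0 - 1)),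
      gBlock A B n0 (2 * k * n0) ((i : ℝ) * 2 ^ (-(2 * k * n0 : ℤ)))
        ((2 * i' : ℝ) * 2 ^ (-(2 * k * n0 : ℤ))) x

end

section DyadicIntervals

lemma indInt_eq_ite (k i : ℤ) (x : ℝ) :
    indInt k i x = if ⌊x / (2:ℝ) ^ k⌋ = i then 1 else 0 := by
  have h : (0:ℝ) < 2 ^ k := by positivity
  unfold indInt
  simp only [Set.indicator_apply, Set.mem_Ico, Int.floor_eq_iff, le_div_iff₀ h, div_lt_iff₀ h]

lemma indInt_le_one (k i : ℤ) (x : ℝ) : indInt k i x ≤ 1 := by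
  rw [indInt_eq_ite]; split_ifs <;> norm_num

lemma indInt_nonneg (k i : ℤ) (x : ℝ) : 0 ≤ indInt k i x := by
  rw [indInt_eq_ite]; split_ifs <;> norm_num

lemma measurable_indInt (k i : ℤ) : Measurable (indInt k i) :=
  measurable_const.indicator measurableSet_Ico

lemma integral_indInt (k i : ℤ) : ∫ x, indInt k i x = 2 ^ k := by
  unfold indInt
  rw [integral_indicator measurableSet_Ico]
  simp only [MeasurableSet.univ, integral_const, measureReal_restrict_apply, Set.univ_inter,
    Real.volume_real_Ico, smul_eq_mul, mul_one, add_mul, one_mul, add_sub_cancel_left]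
  exact max_eq_left (by positivity)

lemma integrable_indInt (k i : ℤ) : Integrable (indInt k i) := by
  unfold indInt
  rw [integrable_indicator_iff measurableSet_Ico]
  simp

/-- A dyadic interval of length `2^k` lies in exactly one of length `2^(k+m)`. -/
lemma indInt_mul_indInt (k : ℤ) (m : ℕ) (i i' : ℤ) (x : ℝ) :
    indInt k i x * indInt (k + m) i' x = (if i / (2:ℤ) ^ m = i' then 1 else 0) * indInt k i x := by
  have h : ⌊x / (2:ℝ) ^ (k + m)⌋ = ⌊x / (2:ℝ) ^ k⌋ / (2:ℤ) ^ m := by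
    rw [zpow_add₀ (by norm_num), ← div_div, zpow_natCast]
    exact_mod_cast Int.floor_div_natCast (x / (2:ℝ) ^ k) (2 ^ m)
  rw [indInt_eq_ite, indInt_eq_ite, h]
  by_cases hi : ⌊x / (2:ℝ) ^ k⌋ = i
  · simp [hi]
  · simp [hi]

lemma haarInt_eq_sub (k i : ℤ) (x : ℝ) :
    haarInt k i x = indInt (k - 1) (2 * i) x - indInt (k - 1) (2 * i + 1) x := by
  have h : (0:ℝ) < 2 ^ (k - 1) := by positivity
  have hk : (2:ℝ) ^ k = 2 * 2 ^ (k - 1) := by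
    rw [zpow_sub_one₀ (by norm_num)]; ring
  unfold haarInt haar0 indInt
  have h2 : (0:ℝ) < 2 * 2 ^ (k - 1) := by positivity
  simp only [Set.indicator_apply, Set.mem_Ico, hk, le_div_iff₀ h2, div_lt_iff₀ h2]
  push_cast
  congr 1 <;> refine if_congr ?_ rfl rfl <;>
    constructor <;> rintro ⟨h1, h2⟩ <;> constructor <;> linarith

lemma measurable_haarInt (k i : ℤ) : Measurable (haarInt k i) := by
  rw [funext (haarInt_eq_sub k i)]
  exact (measurable_indInt _ _).sub (measurable_indInt _ _)

lemma integrable_haarInt (k i : ℤ) : Integrable (haarInt k i) := by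
  rw [funext (haarInt_eq_sub k i)]
  exact (integrable_indInt _ _).sub (integrable_indInt _ _)

lemma integral_haarInt (k i : ℤ) : ∫ x, haarInt k i x = 0 := by
  simp_rw [haarInt_eq_sub]
  rw [integral_sub (integrable_indInt _ _) (integrable_indInt _ _)]
  simp [integral_indInt]

lemma indInt_mul_indInt_of_ne {k i i' : ℤ} (h : i ≠ i') (x : ℝ) :
    indInt k i x * indInt k i' x = 0 := by
  simpa [h] using indInt_mul_indInt k 0 i i' x

lemma haarInt_mul_indInt (k i : ℤ) (x : ℝ) : haarInt k i x * indInt k i x = haarInt k i x := by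
  have h1 := indInt_mul_indInt (k - 1) 1 (2 * i) i x
  have h2 := indInt_mul_indInt (k - 1) 1 (2 * i + 1) i x
  rw [haarInt_eq_sub, sub_mul]
  simp only [Nat.cast_one, sub_add_cancel] at h1 h2
  rw [h1, h2, if_pos (by omega), if_pos (by omega)]
  ring

lemma haarInt_mul_self (k i : ℤ) (x : ℝ) : haarInt k i x * haarInt k i x = indInt k i x := by
  have h1 := indInt_mul_indInt (k - 1) 0 (2 * i) (2 * i + 1) x
  have h2 := indInt_mul_indInt (k - 1) 0 (2 * i) (2 * i) x
  have h3 := indInt_mul_indInt (k - 1) 0 (2 * i + 1) (2 * i + 1) x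
  have h4 : indInt k i x = indInt (k - 1) (2 * i) x + indInt (k - 1) (2 * i + 1) x := by
    have h : (0:ℝ) < 2 ^ (k - 1) := by positivity
    have hk : (2:ℝ) ^ k = 2 * 2 ^ (k - 1) := by
      rw [zpow_sub_one₀ (by norm_num)]; ring
    unfold indInt
    simp only [Set.indicator_apply, Set.mem_Ico, hk]
    push_cast
    split_ifs <;> grind
  simp at h1 h2 h3
  rw [haarInt_eq_sub, h4]
  rw [sub_mul, mul_sub, mul_sub, h2, h3, mul_comm (indInt (k - 1) (2 * i + 1) x)]
  rcases h1 with h1 | h1 <;> simp [h1]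

lemma haarInt_mul_haarInt_of_ne {k i i' : ℤ} (h : i ≠ i') (x : ℝ) :
    haarInt k i x * haarInt k i' x = 0 := by
  rw [← haarInt_mul_indInt k i, ← haarInt_mul_indInt k i', mul_mul_mul_comm,
    indInt_mul_indInt_of_ne h, mul_zero]

lemma abs_haarInt_le (k i : ℤ) (x : ℝ) : |haarInt k i x| ≤ 1 := by
  rw [haarInt_eq_sub, abs_le]
  have := indInt_nonneg (k - 1) (2 * i) x
  have := indInt_nonneg (k - 1) (2 * i + 1) x
  have := indInt_le_one (k - 1) (2 * i) x
  have := indInt_le_one (k - 1) (2 * i + 1) x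
  constructor <;> linarith

/-- A Haar function is constant on every strictly smaller dyadic interval. -/
lemma exists_indInt_mul_haarInt {k k' : ℤ} (h : k < k') (i i' : ℤ) :
    ∃ c : ℝ, ∀ x, indInt k i x * haarInt k' i' x = c * indInt k i x := by
  obtain ⟨m, hm⟩ : ∃ m : ℕ, k' - 1 = k + m := ⟨(k' - 1 - k).toNat, by omega⟩
  refine ⟨(if i / (2:ℤ) ^ m = 2 * i' then 1 else 0) -
    (if i / (2:ℤ) ^ m = 2 * i' + 1 then 1 else 0), fun x => ?_⟩
  rw [haarInt_eq_sub, hm, mul_sub, indInt_mul_indInt, indInt_mul_indInt]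
  ring

lemma integral_haarInt_mul_haarInt_of_lt {k k' : ℤ} (h : k < k') (i i' : ℤ) :
    ∫ x, haarInt k i x * haarInt k' i' x = 0 := by
  obtain ⟨c, hc⟩ := exists_indInt_mul_haarInt h i i'
  have (x : ℝ) : haarInt k i x * haarInt k' i' x = c * haarInt k i x := by
    rw [← haarInt_mul_indInt k i, mul_assoc, hc]; ring
  simp_rw [this]
  rw [integral_const_mul, integral_haarInt, mul_zero]

end DyadicIntervals

section Cubes

lemma integral_prod_two (f g : ℝ → ℝ) :
    ∫ x : Fin 2 → ℝ, f (x 0) * g (x 1) = (∫ x, f x) * ∫ x, g x := by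
  simpa [Fin.prod_univ_two] using
    integral_fintype_prod_volume_eq_prod (𝕜 := ℝ) (ι := Fin 2) (fun t => if t = 0 then f else g)

lemma integrable_prod_two {f g : ℝ → ℝ} (hf : Integrable f) (hg : Integrable g) :
    Integrable fun x : Fin 2 → ℝ => f (x 0) * g (x 1) := by
  have := Integrable.fintype_prod (𝕜 := ℝ) (ι := Fin 2) (μ := fun _ => volume)
    (f := fun t => if t = 0 then f else g) (by intro t; fin_cases t <;> simpa)
  rw [volume_pi]
  simpa [Fin.prod_univ_two] using this

lemma haarCube_two (Q : DyadicCube 2) (x : Fin 2 → ℝ) :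
    haarCube 2 (stdDir 2 0) Q x = haarInt Q.1 (Q.2 0) (x 0) * indInt Q.1 (Q.2 1) (x 1) := by
  simp [haarCube, stdDir, Fin.prod_univ_two]

lemma measurable_haarCube (Q : DyadicCube 2) : Measurable (haarCube 2 (stdDir 2 0) Q) := by
  rw [funext (haarCube_two Q)]
  exact ((measurable_haarInt _ _).comp (measurable_pi_apply _)).mul
    ((measurable_indInt _ _).comp (measurable_pi_apply _))

lemma integrable_haarCube (Q : DyadicCube 2) : Integrable (haarCube 2 (stdDir 2 0) Q) := by
  rw [funext (haarCube_two Q)]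
  exact integrable_prod_two (integrable_haarInt _ _) (integrable_indInt _ _)

lemma abs_haarCube_le (Q : DyadicCube 2) (x : Fin 2 → ℝ) :
    |haarCube 2 (stdDir 2 0) Q x| ≤ 1 := by
  rw [haarCube_two, abs_mul, abs_of_nonneg (indInt_nonneg _ _ _)]
  exact mul_le_one₀ (abs_haarInt_le _ _ _) (indInt_nonneg _ _ _) (indInt_le_one _ _ _)

lemma cubeVol_two (Q : DyadicCube 2) : cubeVol 2 Q = 2 ^ Q.1 * 2 ^ Q.1 := by
  rw [cubeVol, ← zpow_add₀ (by norm_num)]; congr 1; push_cast; ring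

lemma cubeVol_pos (Q : DyadicCube 2) : 0 < cubeVol 2 Q := by
  unfold cubeVol; positivity

lemma integral_haarCube_mul_haarCube (Q R : DyadicCube 2) :
    ∫ x, haarCube 2 (stdDir 2 0) Q x * haarCube 2 (stdDir 2 0) R x =
      if Q = R then cubeVol 2 Q else 0 := by
  have key : ∫ x, haarCube 2 (stdDir 2 0) Q x * haarCube 2 (stdDir 2 0) R x =
      (∫ x, haarInt Q.1 (Q.2 0) x * haarInt R.1 (R.2 0) x) *
        ∫ x, indInt Q.1 (Q.2 1) x * indInt R.1 (R.2 1) x := by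
    rw [← integral_prod_two]
    congr 1 with x
    rw [haarCube_two, haarCube_two]; ring
  rw [key]
  obtain ⟨k, p⟩ := Q
  obtain ⟨k', p'⟩ := R
  rcases lt_trichotomy k k' with h | rfl | h
  · rw [integral_haarInt_mul_haarInt_of_lt h, if_neg (by simp [h.ne]), zero_mul]
  · by_cases h0 : p 0 = p' 0
    · by_cases h1 : p 1 = p' 1
      · have : p = p' := by ext t; fin_cases t <;> assumption
        subst this
        have hi (x : ℝ) : indInt k (p 1) x * indInt k (p 1) x = indInt k (p 1) x := by
          simpa using indInt_mul_indInt k 0 (p 1) (p 1) x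
        simp [haarInt_mul_self, hi, integral_indInt, cubeVol_two]
      · rw [if_neg (by rintro ⟨⟩; exact h1 rfl)]
        simp [indInt_mul_indInt_of_ne h1]
    · rw [if_neg (by rintro ⟨⟩; exact h0 rfl)]
      simp [haarInt_mul_haarInt_of_ne h0]
  · simp_rw [mul_comm (haarInt k _ _)]
    rw [integral_haarInt_mul_haarInt_of_lt h, if_neg (by simp [h.ne']), zero_mul]

end Cubes

section Projection

lemma abs_haarCube_le_mul_self (Q : DyadicCube 2) (x : Fin 2 → ℝ) :
    |haarCube 2 (stdDir 2 0) Q x| ≤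
      haarCube 2 (stdDir 2 0) Q x * haarCube 2 (stdDir 2 0) Q x := by
  have h : haarCube 2 (stdDir 2 0) Q x * (haarCube 2 (stdDir 2 0) Q x *
      haarCube 2 (stdDir 2 0) Q x) = haarCube 2 (stdDir 2 0) Q x := by
    have h1 := haarInt_mul_self Q.1 (Q.2 0) (x 0)
    have h2 := haarInt_mul_indInt Q.1 (Q.2 0) (x 0)
    have h3 : indInt Q.1 (Q.2 1) (x 1) * indInt Q.1 (Q.2 1) (x 1) = indInt Q.1 (Q.2 1) (x 1) := by
      simpa using indInt_mul_indInt Q.1 0 (Q.2 1) (Q.2 1) (x 1)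
    rw [haarCube_two]
    linear_combination (haarInt Q.1 (Q.2 0) (x 0)) * (indInt Q.1 (Q.2 1) (x 1)) ^ 3 * h1
      + (indInt Q.1 (Q.2 1) (x 1)) ^ 3 * h2
      + haarInt Q.1 (Q.2 0) (x 0) * (indInt Q.1 (Q.2 1) (x 1) + 1) * h3
  conv_lhs => rw [← h, abs_mul, abs_mul_self]
  exact mul_le_of_le_one_left (mul_self_nonneg _) (abs_haarCube_le Q x)

lemma measurable_haarProj (u : (Fin 2 → ℝ) → ℝ) :
    Measurable (haarProj 2 (stdDir 2 0) u) :=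
  Measurable.tsum fun Q => ((measurable_haarCube Q).const_mul _).div_const _

lemma integrable_haarCube_mul_sum (Q : DyadicCube 2) (T : Finset (DyadicCube 2)) :
    Integrable fun x => haarCube 2 (stdDir 2 0) Q x * ∑ R ∈ T, haarCube 2 (stdDir 2 0) R x := by
  simp_rw [Finset.mul_sum]
  exact integrable_finsetSum _ fun R _ => (integrable_haarCube Q).mul_bdd
    (measurable_haarCube R).aestronglyMeasurable (.of_forall (abs_haarCube_le R))

lemma integral_haarCube_mul_sum (Q : DyadicCube 2) (T : Finset (DyadicCube 2)) :
    ∫ x, haarCube 2 (stdDir 2 0) Q x * ∑ R ∈ T, haarCube 2 (stdDir 2 0) R x =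
      if Q ∈ T then cubeVol 2 Q else 0 := by
  simp_rw [Finset.mul_sum]
  rw [integral_finsetSum _ fun R _ => (integrable_haarCube Q).mul_bdd
    (measurable_haarCube R).aestronglyMeasurable (.of_forall (abs_haarCube_le R))]
  simp [integral_haarCube_mul_haarCube]

/-- The projection is self-adjoint against finite sums of Haar functions. -/
lemma integral_haarProj_mul_sum {u : (Fin 2 → ℝ) → ℝ}
    (hu : Summable fun Q => ∫ y, u y * haarCube 2 (stdDir 2 0) Q y) (T : Finset (DyadicCube 2)) :
    ∫ x, haarProj 2 (stdDir 2 0) u x * ∑ R ∈ T, haarCube 2 (stdDir 2 0) R x =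
      ∑ R ∈ T, ∫ y, u y * haarCube 2 (stdDir 2 0) R y := by
  set a : DyadicCube 2 → ℝ := fun Q => ∫ y, u y * haarCube 2 (stdDir 2 0) Q y with ha
  set φ : (Fin 2 → ℝ) → ℝ := fun x => ∑ R ∈ T, haarCube 2 (stdDir 2 0) R x with hφ
  have hF (Q : DyadicCube 2) : (fun x => a Q * haarCube 2 (stdDir 2 0) Q x / cubeVol 2 Q * φ x) =
      fun x => a Q / cubeVol 2 Q * (haarCube 2 (stdDir 2 0) Q x * φ x) := by
    ext x; ring
  have hφ_le (x : Fin 2 → ℝ) : |φ x| ≤ T.card := by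
    refine (Finset.abs_sum_le_sum_abs _ _).trans ?_
    simpa using Finset.sum_le_sum fun R (_ : R ∈ T) => abs_haarCube_le R x
  have hnorm (Q : DyadicCube 2) :
      ‖∫ x, ‖a Q * haarCube 2 (stdDir 2 0) Q x / cubeVol 2 Q * φ x‖‖ ≤ |a Q| * T.card := by
    have hQ := cubeVol_pos Q
    rw [Real.norm_of_nonneg (integral_nonneg fun _ => norm_nonneg _)]
    have hQQ : ∫ x, haarCube 2 (stdDir 2 0) Q x * haarCube 2 (stdDir 2 0) Q x = cubeVol 2 Q := by
      simp [integral_haarCube_mul_haarCube]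
    calc _ ≤ ∫ x, |a Q| / cubeVol 2 Q * T.card *
          (haarCube 2 (stdDir 2 0) Q x * haarCube 2 (stdDir 2 0) Q x) := by
          refine integral_mono ?_ ?_ fun x => ?_
          · refine Integrable.norm ?_
            rw [hF]
            exact (integrable_haarCube_mul_sum Q T).const_mul _
          · exact ((integrable_haarCube Q).mul_bdd
              (measurable_haarCube Q).aestronglyMeasurable
              (.of_forall (abs_haarCube_le Q))).const_mul _
          · simp only [Real.norm_eq_abs, abs_mul, abs_div, abs_of_pos hQ]
            calc _ = |a Q| / cubeVol 2 Q * (|φ x| * |haarCube 2 (stdDir 2 0) Q x|) := by ring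
              _ ≤ |a Q| / cubeVol 2 Q * (T.card * (haarCube 2 (stdDir 2 0) Q x *
                    haarCube 2 (stdDir 2 0) Q x)) := by
                  gcongr
                  · exact hφ_le x
                  · exact abs_haarCube_le_mul_self Q x
              _ = _ := by ring
      _ = _ := by
          rw [integral_const_mul, hQQ]
          field_simp
  have key := hasSum_integral_of_summable_integral_norm (μ := volume)
    (F := fun Q x => a Q * haarCube 2 (stdDir 2 0) Q x / cubeVol 2 Q * φ x)
    (fun Q => by rw [hF]; exact (integrable_haarCube_mul_sum Q T).const_mul _)
    ((hu.abs.mul_right _).of_norm_bounded hnorm)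
  have hint (Q : DyadicCube 2) : ∫ x, a Q * haarCube 2 (stdDir 2 0) Q x / cubeVol 2 Q * φ x =
      if Q ∈ T then a Q else 0 := by
    rw [hF, integral_const_mul, integral_haarCube_mul_sum]
    have := (cubeVol_pos Q).ne'
    split_ifs <;> simp [this]
  simp only [hint, tsum_mul_right] at key
  have key2 : HasSum (fun Q => if Q ∈ T then a Q else 0) (∑ Q ∈ T, a Q) := by
    have := hasSum_sum_of_ne_finset_zero (f := fun Q => if Q ∈ T then a Q else 0) (s := T)
      (L := .unconditional _)
      (fun Q hQ => if_neg hQ)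
    rwa [Finset.sum_congr rfl fun Q hQ => if_pos hQ] at this
  exact key.unique key2

lemma eLpNorm_two_sum_haarCube (T : Finset (DyadicCube 2)) :
    eLpNorm (fun x => ∑ R ∈ T, haarCube 2 (stdDir 2 0) R x) 2 volume =
      ENNReal.ofReal ((∑ R ∈ T, cubeVol 2 R) ^ ((1:ℝ) / 2)) := by
  set φ : (Fin 2 → ℝ) → ℝ := fun x => ∑ R ∈ T, haarCube 2 (stdDir 2 0) R x with hφ
  have hφφ (x : Fin 2 → ℝ) : φ x ^ 2 = ∑ Q ∈ T, haarCube 2 (stdDir 2 0) Q x * φ x := by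
    rw [sq, ← Finset.sum_mul]
  have hint : ∫ x, φ x ^ 2 = ∑ R ∈ T, cubeVol 2 R := by
    simp_rw [hφφ]
    rw [integral_finsetSum _ fun Q _ => integrable_haarCube_mul_sum Q T]
    exact Finset.sum_congr rfl fun Q hQ => (integral_haarCube_mul_sum Q T).trans (if_pos hQ)
  have hL : ∫⁻ x, ‖φ x‖ₑ ^ (2:ℝ) = ENNReal.ofReal (∑ R ∈ T, cubeVol 2 R) := by
    rw [← hint, ofReal_integral_eq_lintegral_ofReal]
    · refine lintegral_congr fun x => ?_
      rw [← ofReal_norm, ENNReal.ofReal_rpow_of_nonneg (norm_nonneg _) (by norm_num)]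
      norm_num
    · simp_rw [hφφ]
      exact integrable_finsetSum _ fun Q _ => integrable_haarCube_mul_sum Q T
    · exact .of_forall fun x => sq_nonneg _
  rw [eLpNorm_eq_lintegral_rpow_enorm_toReal (by norm_num) (by norm_num), ENNReal.toReal_ofNat, hL,
    ENNReal.ofReal_rpow_of_nonneg (Finset.sum_nonneg fun R _ => (cubeVol_pos R).le) (by norm_num)]

/-- Duality: testing against a finite sum of Haar functions bounds the projection from below. -/
lemma ofReal_sum_coeff_le {u : (Fin 2 → ℝ) → ℝ}
    (hu : Summable fun Q => ∫ y, u y * haarCube 2 (stdDir 2 0) Q y) (T : Finset (DyadicCube 2)) :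
    ENNReal.ofReal (∑ R ∈ T, ∫ y, u y * haarCube 2 (stdDir 2 0) R y) ≤
      eLpNorm (haarProj 2 (stdDir 2 0) u) 2 volume *
        ENNReal.ofReal ((∑ R ∈ T, cubeVol 2 R) ^ ((1:ℝ) / 2)) := by
  rw [← integral_haarProj_mul_sum hu, ← eLpNorm_two_sum_haarCube]
  set φ : (Fin 2 → ℝ) → ℝ := fun x => ∑ R ∈ T, haarCube 2 (stdDir 2 0) R x with hφ
  have hm : Measurable φ := Finset.measurable_fun_sum _ fun R _ => measurable_haarCube R
  refine le_trans ?_ (eLpNorm_smul_le_mul_eLpNorm (r := 1) hm.aestronglyMeasurable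
    (measurable_haarProj u).aestronglyMeasurable)
  rw [eLpNorm_one_eq_lintegral_enorm]
  calc _ ≤ ‖∫ x, haarProj 2 (stdDir 2 0) u x * φ x‖ₑ := by
        rw [← ofReal_norm]
        exact ENNReal.ofReal_le_ofReal (le_abs_self _)
    _ ≤ _ := enorm_integral_le_lintegral_enorm _

end Projection

section Coefficients

lemma integral_comp_sub_mul (f : ℝ → ℝ) (l : ℝ) {c : ℝ} (hc : 0 < c) :
    ∫ x, f ((x - l) * c) = c⁻¹ * ∫ x, f x := by
  rw [integral_sub_right_eq_self (fun x => f (x * c)) l, Measure.integral_comp_mul_right,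
    abs_of_pos (inv_pos.2 hc), smul_eq_mul]

/-- The first-coordinate factor of `⟨g_Q, h_R⟩`. -/
noncomputable def coeffA (A : ℝ → ℝ) (j i : ℕ) (k p : ℤ) : ℝ :=
  ∫ x, A ((x - (i : ℝ) * 2 ^ (-(j : ℤ))) * 2 ^ j) * haarInt k p x

/-- The second-coordinate factor of `⟨g_Q, h_R⟩`. -/
noncomputable def coeffB (B : ℝ → ℝ) (n0 j i : ℕ) (k p : ℤ) : ℝ :=
  ∫ x, B ((x - (2 * i : ℝ) * 2 ^ (-(j : ℤ))) * 2 ^ j * 2 ^ n0) * indInt k p x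

variable {A B : ℝ → ℝ}

lemma block_mul_indInt (hA : ∀ t, t ∉ Set.Ico (0:ℝ) 1 → A t = 0) (j i : ℕ) (x : ℝ) :
    indInt (-j) i x * A ((x - (i : ℝ) * 2 ^ (-(j : ℤ))) * 2 ^ j) =
      A ((x - (i : ℝ) * 2 ^ (-(j : ℤ))) * 2 ^ j) := by
  by_cases h : (x - (i : ℝ) * 2 ^ (-(j : ℤ))) * 2 ^ j ∈ Set.Ico (0:ℝ) 1
  · rw [indInt_eq_ite, if_pos, one_mul]
    have h2 : (i : ℝ) * 2 ^ (-(j : ℤ)) * 2 ^ j = i := by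
      rw [zpow_neg, zpow_natCast]; field_simp
    rw [sub_mul, h2] at h
    rw [zpow_neg, zpow_natCast, div_inv_eq_mul, Int.floor_eq_iff]
    push_cast
    exact ⟨by linarith [h.1], by linarith [h.2]⟩
  · rw [hA _ h, mul_zero]

lemma coeffA_eq_zero_of_lt (hA : ∀ t, t ∉ Set.Ico (0:ℝ) 1 → A t = 0) (hA0 : ∫ t, A t = 0)
    {j i : ℕ} {k p : ℤ} (hk : -(j : ℤ) < k) : coeffA A j i k p = 0 := by
  obtain ⟨c, hc⟩ := exists_indInt_mul_haarInt hk i p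
  have (x : ℝ) : A ((x - (i : ℝ) * 2 ^ (-(j : ℤ))) * 2 ^ j) * haarInt k p x =
      c * A ((x - (i : ℝ) * 2 ^ (-(j : ℤ))) * 2 ^ j) := by
    conv_lhs => rw [← block_mul_indInt hA j i x]
    conv_rhs => rw [← block_mul_indInt hA j i x]
    linear_combination A ((x - (i : ℝ) * 2 ^ (-(j : ℤ))) * 2 ^ j) * hc x
  rw [coeffA]
  simp_rw [this]
  rw [integral_const_mul, integral_comp_sub_mul _ _ (by positivity), hA0, mul_zero, mul_zero]

lemma coeffA_self (hA : ∀ t, t ∉ Set.Ico (0:ℝ) 1 → A t = 0) (j i : ℕ) (p : ℤ) :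
    coeffA A j i (-j) p = if p = i then ((2:ℝ) ^ j)⁻¹ * ∫ t, A t * haar0 t else 0 := by
  split_ifs with h
  · subst h
    rw [coeffA, ← integral_comp_sub_mul (fun t => A t * haar0 t) ((i : ℝ) * 2 ^ (-(j : ℤ)))
      (by positivity)]
    congr 1 with x
    simp [haarInt]
  · rw [coeffA]
    have (x : ℝ) : A ((x - (i : ℝ) * 2 ^ (-(j : ℤ))) * 2 ^ j) * haarInt (-j) p x = 0 := by
      rw [← block_mul_indInt hA j i x, ← haarInt_mul_indInt]
      linear_combination A ((x - (i : ℝ) * 2 ^ (-(j : ℤ))) * 2 ^ j) * haarInt (-j) p x *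
        indInt_mul_indInt_of_ne (Ne.symm h) (k := -j) x
    simp only [this, integral_zero]

lemma coeffA_ne_zero (hA : ∀ t, t ∉ Set.Ico (0:ℝ) 1 → A t = 0) (hA0 : ∫ t, A t = 0)
    {j i : ℕ} (hi : i < 2 ^ j) {k p : ℤ} (h : coeffA A j i k p ≠ 0) :
    ∃ m : ℕ, k = -m ∧ 0 ≤ p ∧ p < 2 ^ m := by
  have hk : k ≤ -(j : ℤ) := not_lt.1 fun hk => h (coeffA_eq_zero_of_lt hA hA0 hk)
  obtain ⟨s, hs⟩ : ∃ s : ℕ, -(j : ℤ) = k + s := ⟨(-j - k).toNat, by omega⟩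
  refine ⟨j + s, by push_cast; omega, ?_⟩
  by_contra hp
  refine h ?_
  have hne : p / 2 ^ s ≠ i := by
    intro hpi
    have h0 : (0:ℤ) < 2 ^ s := by positivity
    apply hp
    rw [Int.ediv_eq_iff_of_pos h0] at hpi
    have hi' : (i:ℤ) + 1 ≤ 2 ^ j := by exact_mod_cast hi
    refine ⟨le_trans (by positivity) hpi.1, hpi.2.trans_le ?_⟩
    rw [pow_add]
    nlinarith
  have (x : ℝ) : A ((x - (i : ℝ) * 2 ^ (-(j : ℤ))) * 2 ^ j) * haarInt k p x = 0 := by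
    have h1 := indInt_mul_indInt k s p i x
    rw [if_neg hne, zero_mul, ← hs] at h1
    rw [← block_mul_indInt hA j i x, ← haarInt_mul_indInt]
    linear_combination A ((x - (i : ℝ) * 2 ^ (-(j : ℤ))) * 2 ^ j) * haarInt k p x * h1
  simp only [coeffA, this, integral_zero]

lemma abs_coeffA_le {L : NNReal} (hL : LipschitzWith L A) (hb : ∃ C, ∀ t, |A t| ≤ C) (j i : ℕ)
    (k p : ℤ) : |coeffA A j i k p| ≤ L * 2 ^ j * (2 ^ k * 2 ^ k) := by
  set f : ℝ → ℝ := fun x => A ((x - (i : ℝ) * 2 ^ (-(j : ℤ))) * 2 ^ j) with hf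
  set y : ℝ := p * 2 ^ k
  obtain ⟨C, hC⟩ := hb
  have hfm : Measurable f := hL.continuous.measurable.comp (by fun_prop)
  have hint : Integrable fun x => f x * haarInt k p x :=
    (integrable_haarInt k p).bdd_mul hfm.aestronglyMeasurable (.of_forall fun x => hC _)
  have h2k : (0:ℝ) < 2 ^ k := by positivity
  have hsub : coeffA A j i k p = ∫ x, (f x - f y) * haarInt k p x := by
    simp_rw [sub_mul]
    rw [integral_sub hint ((integrable_haarInt k p).const_mul _), integral_const_mul,
      integral_haarInt, mul_zero, sub_zero, coeffA]
  have hpt (x : ℝ) : ‖(f x - f y) * haarInt k p x‖ ≤ L * 2 ^ j * 2 ^ k * indInt k p x := by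
    by_cases hx : ⌊x / (2:ℝ) ^ k⌋ = p
    · rw [indInt_eq_ite, if_pos hx, mul_one, norm_mul]
      rw [Int.floor_eq_iff, le_div_iff₀ h2k, div_lt_iff₀ h2k] at hx
      have hxy : |x - y| ≤ 2 ^ k := by
        rw [abs_le]; constructor <;> simp only [y] <;> linarith
      have h1 : ‖f x - f y‖ ≤ L * 2 ^ j * 2 ^ k := by
        calc _ ≤ L * ‖(x - (i : ℝ) * 2 ^ (-(j : ℤ))) * 2 ^ j -
              (y - (i : ℝ) * 2 ^ (-(j : ℤ))) * 2 ^ j‖ := hL.norm_sub_le _ _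
          _ = L * (2 ^ j * |x - y|) := by
              rw [← sub_mul, sub_sub_sub_cancel_right, norm_mul, mul_comm (2 ^ j : ℝ)]
              simp
          _ ≤ L * (2 ^ j * 2 ^ k) := by gcongr
          _ = _ := by ring
      exact (mul_le_mul h1 (abs_haarInt_le k p x) (abs_nonneg _) (by positivity)).trans_eq (mul_one _)
    · have : haarInt k p x = 0 := by
        rw [← haarInt_mul_indInt, indInt_eq_ite, if_neg hx, mul_zero]
      rw [this, mul_zero, norm_zero]
      exact mul_nonneg (by positivity) (indInt_nonneg _ _ _)
  rw [hsub]
  calc _ ≤ ∫ x, L * 2 ^ j * 2 ^ k * indInt k p x :=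
        norm_integral_le_of_norm_le ((integrable_indInt k p).const_mul _) (.of_forall hpt)
    _ = _ := by rw [integral_const_mul, integral_indInt]; ring

lemma abs_coeffB_le (hB : ∀ t, |B t| ≤ 1) (n0 j i : ℕ) (k p : ℤ) :
    |coeffB B n0 j i k p| ≤ 2 ^ k := by
  rw [← integral_indInt k p, coeffB, ← Real.norm_eq_abs]
  refine norm_integral_le_of_norm_le (integrable_indInt k p) (.of_forall fun x => ?_)
  rw [norm_mul, Real.norm_of_nonneg (indInt_nonneg k p x)]
  exact mul_le_of_le_one_left (indInt_nonneg k p x) (hB _)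

lemma coeffB_ne_zero (hB : ∀ t, t ∉ Set.Ico (-1:ℝ) 1 → B t = 0)
    {n0 j i : ℕ} (hj : 1 ≤ j) (hi : i < 2 ^ (j - 1)) {m : ℕ} {p : ℤ}
    (h : coeffB B n0 j i (-m) p ≠ 0) : -2 ^ m ≤ p ∧ p < 2 ^ m := by
  by_contra hp
  refine h ?_
  have (x : ℝ) : B ((x - (2 * i : ℝ) * 2 ^ (-(j : ℤ))) * 2 ^ j * 2 ^ n0) * indInt (-m) p x = 0 := by
    by_cases hx : (x - (2 * i : ℝ) * 2 ^ (-(j : ℤ))) * 2 ^ j * 2 ^ n0 ∈ Set.Ico (-1:ℝ) 1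
    swap
    · rw [hB _ hx, zero_mul]
    rw [indInt_eq_ite, if_neg, mul_zero]
    intro hfl
    apply hp
    have h2 : (2 * i : ℝ) * 2 ^ (-(j : ℤ)) * 2 ^ j = 2 * i := by
      rw [zpow_neg, zpow_natCast]; field_simp
    rw [sub_mul, h2] at hx
    have hn : (1:ℝ) ≤ 2 ^ n0 := one_le_pow₀ (by norm_num)
    have hj2 : (1:ℝ) ≤ 2 ^ j := one_le_pow₀ (by norm_num)
    have hi2 : (2:ℝ) * i + 2 ≤ 2 ^ j := by
      have : i + 1 ≤ 2 ^ (j - 1) := hi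
      have h3 : 2 ^ j = 2 * 2 ^ (j - 1) := by rw [← pow_succ']; congr 1; omega
      have : 2 * i + 2 ≤ 2 ^ j := by omega
      exact_mod_cast this
    have hi0 : (0:ℝ) ≤ i := by positivity
    have hlo : -1 ≤ x * 2 ^ j - 2 * i := by
      by_contra! hc
      nlinarith [hx.1]
    have hhi : x * 2 ^ j - 2 * i < 1 := by
      by_contra! hc
      nlinarith [hx.2]
    have hx1 : -1 ≤ x := by
      by_contra! hc
      nlinarith
    have hx2 : x < 1 := by
      by_contra! hc
      nlinarith
    rw [zpow_neg, zpow_natCast, div_inv_eq_mul] at hfl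
    have hm : (0:ℝ) < 2 ^ m := by positivity
    rw [← hfl, Int.le_floor, Int.floor_lt]
    push_cast
    constructor <;> nlinarith
  simp only [coeffB, this, integral_zero]

end Coefficients

section Summability

variable {A B : ℝ → ℝ}

lemma summable_ite_box (C : ℝ) (hC : 0 ≤ C) :
    Summable fun Q : DyadicCube 2 =>
      if Q.2 ∈ Fintype.piFinset (fun _ : Fin 2 => Finset.Ico (-2 ^ Q.1.natAbs : ℤ) (2 ^ Q.1.natAbs))
        then C * (1 / 8) ^ Q.1.natAbs else 0 := by
  rw [summable_prod_of_nonneg (fun Q => by dsimp only [Pi.zero_apply]; split_ifs <;> positivity)]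
  refine ⟨fun k => summable_of_ne_finset_zero (s := Fintype.piFinset (fun _ : Fin 2 =>
    Finset.Ico (-2 ^ k.natAbs : ℤ) (2 ^ k.natAbs))) fun p hp => if_neg hp, ?_⟩
  have h (k : ℤ) : ∑' p : Fin 2 → ℤ, (if p ∈ Fintype.piFinset (fun _ : Fin 2 =>
      Finset.Ico (-2 ^ k.natAbs : ℤ) (2 ^ k.natAbs)) then C * (1 / 8) ^ k.natAbs else 0) =
      4 * C * (1 / 2) ^ k.natAbs := by
    rw [tsum_eq_sum (s := Fintype.piFinset (fun _ : Fin 2 =>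
      Finset.Ico (-2 ^ k.natAbs : ℤ) (2 ^ k.natAbs))) fun p hp => if_neg hp,
      Finset.sum_congr rfl fun p hp => if_pos hp]
    have hcard : ((2:ℤ) ^ k.natAbs + 2 ^ k.natAbs).toNat = 2 * 2 ^ k.natAbs := by
      have : (2:ℤ) ^ k.natAbs + 2 ^ k.natAbs = ((2 * 2 ^ k.natAbs : ℕ) : ℤ) := by
        push_cast; ring
      rw [this, Int.toNat_natCast]
    simp only [Finset.sum_const, Fintype.card_piFinset, Int.card_Ico, sub_neg_eq_add, hcard,
      Finset.prod_const, Finset.card_univ, Fintype.card_fin, nsmul_eq_mul]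
    push_cast
    have h8 : (1 / 2 : ℝ) ^ k.natAbs = (2 ^ k.natAbs) ^ 2 * (1 / 8) ^ k.natAbs := by
      rw [pow_right_comm, ← mul_pow]; norm_num
    rw [h8]; ring
  simp_rw [h]
  refine Summable.mul_left _ (Summable.of_nat_of_neg ?_ ?_) <;>
    simpa using summable_geometric_two

lemma summable_coeff_mul_coeff (hA : ∀ t, t ∉ Set.Ico (0:ℝ) 1 → A t = 0) (hA0 : ∫ t, A t = 0)
    {L : NNReal} (hL : LipschitzWith L A) (hb : ∃ C, ∀ t, |A t| ≤ C)
    (hB : ∀ t, t ∉ Set.Ico (-1:ℝ) 1 → B t = 0) (hB1 : ∀ t, |B t| ≤ 1)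
    {n0 j i i' : ℕ} (hj : 1 ≤ j) (hi : i < 2 ^ j) (hi' : i' < 2 ^ (j - 1)) :
    Summable fun Q : DyadicCube 2 =>
      coeffA A j i Q.1 (Q.2 0) * coeffB B n0 j i' Q.1 (Q.2 1) := by
  refine (summable_ite_box (L * 2 ^ j) (by positivity)).of_norm_bounded fun Q => ?_
  by_cases h : coeffA A j i Q.1 (Q.2 0) * coeffB B n0 j i' Q.1 (Q.2 1) = 0
  · rw [h, norm_zero]; split_ifs <;> positivity
  obtain ⟨m, hm, h0⟩ := coeffA_ne_zero hA hA0 hi (left_ne_zero_of_mul h)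
  have h1 := coeffB_ne_zero hB hj hi' (hm ▸ right_ne_zero_of_mul h)
  have hQ : Q.1.natAbs = m := by omega
  rw [if_pos]
  · rw [norm_mul, hQ]
    refine (mul_le_mul (abs_coeffA_le hL hb j i Q.1 (Q.2 0)) (abs_coeffB_le hB1 n0 j i' Q.1 (Q.2 1))
      (abs_nonneg _) (by positivity)).trans_eq ?_
    have h8 : (8:ℝ) = 2 * 2 * 2 := by norm_num
    rw [hm, zpow_neg, zpow_natCast, one_div, h8, mul_inv, mul_inv, mul_pow, mul_pow, inv_pow]
    ring
  · rw [Fintype.mem_piFinset]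
    intro t
    rw [hQ, Finset.mem_Ico]
    have : (0:ℤ) < 2 ^ m := by positivity
    fin_cases t
    · exact ⟨by simp only [Fin.zero_eta]; omega, h0.2⟩
    · exact h1

lemma integrable_block_mul_haarCube (hAm : Measurable A) (hAb : ∃ C, ∀ t, |A t| ≤ C)
    (hBm : Measurable B) (hBb : ∃ C, ∀ t, |B t| ≤ C) (n0 j : ℕ) (l l' : ℝ) (Q : DyadicCube 2) :
    Integrable fun x => gBlock A B n0 j l l' x * haarCube 2 (stdDir 2 0) Q x := by
  obtain ⟨C, hC⟩ := hAb
  obtain ⟨D, hD⟩ := hBb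
  have h1 : Integrable fun x => A ((x - l) * 2 ^ j) * haarInt Q.1 (Q.2 0) x :=
    (integrable_haarInt _ _).bdd_mul (hAm.comp (by fun_prop)).aestronglyMeasurable
      (.of_forall fun x => hC _)
  have h2 : Integrable fun x => B ((x - l') * 2 ^ j * 2 ^ n0) * indInt Q.1 (Q.2 1) x :=
    (integrable_indInt _ _).bdd_mul (hBm.comp (by fun_prop)).aestronglyMeasurable
      (.of_forall fun x => hD _)
  refine (integrable_prod_two h1 h2).congr (.of_forall fun x => ?_)
  simp only [gBlock, haarCube_two]
  ring

lemma integral_fTest_mul_haarCube (hAm : Measurable A) (hAb : ∃ C, ∀ t, |A t| ≤ C)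
    (hBm : Measurable B) (hBb : ∃ C, ∀ t, |B t| ≤ C) (n0 : ℕ) (Q : DyadicCube 2) :
    ∫ x, fTest A B n0 x * haarCube 2 (stdDir 2 0) Q x =
      ∑ k ∈ Finset.Icc 1 (2 ^ n0), ∑ i ∈ Finset.range (2 ^ (2 * k * n0)),
        ∑ i' ∈ Finset.range (2 ^ (2 * k * n0 - 1)),
          coeffA A (2 * k * n0) i Q.1 (Q.2 0) * coeffB B n0 (2 * k * n0) i' Q.1 (Q.2 1) := by
  have hI := integrable_block_mul_haarCube hAm hAb hBm hBb n0 (Q := Q)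
  simp_rw [fTest, Finset.sum_mul]
  rw [integral_finsetSum _ fun k _ => integrable_finsetSum _ fun i _ =>
    integrable_finsetSum _ fun i' _ => hI _ _ _]
  refine Finset.sum_congr rfl fun k _ => ?_
  rw [integral_finsetSum _ fun i _ => integrable_finsetSum _ fun i' _ => hI _ _ _]
  refine Finset.sum_congr rfl fun i _ => ?_
  rw [integral_finsetSum _ fun i' _ => hI _ _ _]
  refine Finset.sum_congr rfl fun i' _ => ?_
  rw [coeffA, coeffB, ← integral_prod_two]
  congr 1 with x
  simp only [gBlock, haarCube_two]
  push_cast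
  ring

lemma summable_integral_fTest_mul_haarCube
    (hA : ∀ t, t ∉ Set.Ico (0:ℝ) 1 → A t = 0) (hA0 : ∫ t, A t = 0)
    {L : NNReal} (hL : LipschitzWith L A) (hb : ∃ C, ∀ t, |A t| ≤ C) (hBm : Measurable B)
    (hB : ∀ t, t ∉ Set.Ico (-1:ℝ) 1 → B t = 0) (hB1 : ∀ t, |B t| ≤ 1) {n0 : ℕ} (hn0 : 1 ≤ n0) :
    Summable fun Q => ∫ x, fTest A B n0 x * haarCube 2 (stdDir 2 0) Q x := by
  simp_rw [integral_fTest_mul_haarCube hL.continuous.measurable hb hBm ⟨1, hB1⟩]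
  refine summable_sum fun k hk => summable_sum fun i hi => summable_sum fun i' hi' =>
    summable_coeff_mul_coeff hA hA0 hL hb hB hB1 ?_ (Finset.mem_range.1 hi) (Finset.mem_range.1 hi')
  have := (Finset.mem_Icc.1 hk).1
  nlinarith

lemma support_haarProj_fTest (hAm : Measurable A)
    (hA : ∀ t, t ∉ Set.Ico (0:ℝ) 1 → A t = 0) (hA0 : ∫ t, A t = 0)
    (hb : ∃ C, ∀ t, |A t| ≤ C) (hBm : Measurable B)
    (hB : ∀ t, t ∉ Set.Ico (-1:ℝ) 1 → B t = 0) (hBb : ∃ C, ∀ t, |B t| ≤ C)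
    {n0 : ℕ} (hn0 : 1 ≤ n0) :
    Function.support (haarProj 2 (stdDir 2 0) (fTest A B n0)) ⊆ Set.Icc (-1 : Fin 2 → ℝ) 1 := by
  intro x hx
  obtain ⟨Q, hQ⟩ : ∃ Q : DyadicCube 2, (∫ y, fTest A B n0 y * haarCube 2 (stdDir 2 0) Q y) *
      haarCube 2 (stdDir 2 0) Q x / cubeVol 2 Q ≠ 0 := by
    by_contra! h
    refine hx ?_
    rw [haarProj, tsum_congr h, tsum_zero]
  have hQ := (div_ne_zero_iff.1 hQ).1
  have hc := left_ne_zero_of_mul hQ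
  have hx0 := right_ne_zero_of_mul hQ
  rw [integral_fTest_mul_haarCube hAm hb hBm hBb] at hc
  obtain ⟨k, hk, hc⟩ := Finset.exists_ne_zero_of_sum_ne_zero hc
  obtain ⟨i, hi, hc⟩ := Finset.exists_ne_zero_of_sum_ne_zero hc
  obtain ⟨i', hi', hc⟩ := Finset.exists_ne_zero_of_sum_ne_zero hc
  have hj : 1 ≤ 2 * k * n0 := by
    have := (Finset.mem_Icc.1 hk).1
    nlinarith
  obtain ⟨m, hm, h0⟩ := coeffA_ne_zero hA hA0 (Finset.mem_range.1 hi) (left_ne_zero_of_mul hc)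
  have h1 := coeffB_ne_zero hB hj (Finset.mem_range.1 hi') (hm ▸ right_ne_zero_of_mul hc)
  have hloc (y : ℝ) (p : ℤ) (hp : -2 ^ m ≤ p ∧ p < 2 ^ m) (hy : indInt Q.1 p y ≠ 0) :
      -1 ≤ y ∧ y ≤ 1 := by
    rw [hm, indInt_eq_ite] at hy
    have hy := of_not_not fun h => hy (if_neg h)
    have h2 : (0:ℝ) < 2 ^ m := by positivity
    rw [zpow_neg, zpow_natCast, div_inv_eq_mul, Int.floor_eq_iff] at hy
    have hp1 : (-2 ^ m : ℝ) ≤ p := by exact_mod_cast hp.1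
    have hp2 : (p : ℝ) + 1 ≤ 2 ^ m := by exact_mod_cast hp.2
    constructor <;> by_contra! <;> nlinarith
  rw [haarCube_two, ← haarInt_mul_indInt] at hx0
  have hx1 := hloc _ _ ⟨le_trans (neg_nonpos.2 (by positivity)) h0.1, h0.2⟩
    (right_ne_zero_of_mul (left_ne_zero_of_mul hx0))
  have hx2 := hloc _ _ h1 (right_ne_zero_of_mul hx0)
  constructor <;> intro t <;> fin_cases t <;> simp [hx1, hx2]

end Summability

section Pairing

variable {A B S : ℝ → ℝ}

lemma coeffB_self (hBS : ∀ t, B t = S t - S (t + 1)) (hS : ∀ t, t ∉ Set.Ico (0:ℝ) 1 → S t = 0)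
    (n0 j i : ℕ) (m : ℤ) :
    coeffB B n0 j i (-j) (2 * m) =
      if m = i then ((2:ℝ) ^ j * 2 ^ n0)⁻¹ * ∫ t, S t else 0 := by
  have h2 : (2 * i : ℝ) * 2 ^ (-(j : ℤ)) * 2 ^ j = 2 * i := by
    rw [zpow_neg, zpow_natCast]; field_simp
  have hn : (1:ℝ) ≤ 2 ^ n0 := one_le_pow₀ (by norm_num)
  have hfl (x : ℝ) : ⌊x / (2:ℝ) ^ (-(j : ℤ))⌋ = 2 * m ↔ 2 * (m:ℝ) ≤ x * 2 ^ j ∧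
      x * 2 ^ j < 2 * m + 1 := by
    rw [zpow_neg, zpow_natCast, div_inv_eq_mul, Int.floor_eq_iff]
    push_cast
    rfl
  split_ifs with h
  · rw [coeffB, ← integral_comp_sub_mul S ((2 * i : ℝ) * 2 ^ (-(j : ℤ))) (by positivity)]
    congr 1 with x
    have hm : (m : ℝ) = i := by exact_mod_cast h
    rw [indInt_eq_ite, if_congr (hfl x) rfl rfl, hm, mul_assoc]
    have hx : (x - (2 * i : ℝ) * 2 ^ (-(j : ℤ))) * (2 ^ j * 2 ^ n0) =
        (x * 2 ^ j - 2 * i) * 2 ^ n0 := by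
      rw [← mul_assoc, sub_mul, h2]
    rw [hx]
    split_ifs with hc
    · rw [mul_one, hBS, hS (_ + 1), sub_zero]
      intro hc'
      nlinarith [hc'.2, hc.1]
    · rw [mul_zero, hS]
      intro hc'
      apply hc
      constructor <;> by_contra! <;> nlinarith [hc'.1, hc'.2]
  · have (x : ℝ) : B ((x - (2 * i : ℝ) * 2 ^ (-(j : ℤ))) * 2 ^ j * 2 ^ n0) *
        indInt (-j) (2 * m) x = 0 := by
      rw [indInt_eq_ite, if_congr (hfl x) rfl rfl, sub_mul, h2]
      split_ifs with hc
      · rcases lt_or_gt_of_ne h with hlt | hlt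
        · have hlt : (m : ℝ) + 1 ≤ i := by exact_mod_cast hlt
          rw [hBS, hS, hS, sub_zero, zero_mul] <;>
            · intro hc'
              nlinarith [hc'.1, hc'.2, hc.1, hc.2]
        · have hlt : (i : ℝ) + 1 ≤ m := by exact_mod_cast hlt
          rw [hBS, hS, hS, sub_zero, zero_mul] <;>
            · intro hc'
              nlinarith [hc'.1, hc'.2, hc.1, hc.2]
      · rw [mul_zero]
    simp only [coeffB, this, integral_zero]

/-- The antiperiodicity of `B` expresses its coefficients as differences of shifted ones. -/
lemma coeffB_eq_sub (hBS : ∀ t, B t = S t - S (t + 1)) (hSm : Measurable S)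
    (hSb : ∃ C, ∀ t, |S t| ≤ C) (n0 j i r : ℕ) (q : ℤ) :
    coeffB B n0 j i (-(j + n0 + r : ℕ)) q =
      coeffB S n0 j i (-(j + n0 + r : ℕ)) q -
        coeffB S n0 j i (-(j + n0 + r : ℕ)) (q + 2 ^ r) := by
  set k : ℤ := -(j + n0 + r : ℕ) with hk
  set l : ℝ := (2 * i : ℝ) * 2 ^ (-(j : ℤ)) with hl
  obtain ⟨C, hC⟩ := hSb
  have hint1 : Integrable fun x => S ((x - l) * 2 ^ j * 2 ^ n0) * indInt k q x :=
    (integrable_indInt _ _).bdd_mul (hSm.comp (by fun_prop)).aestronglyMeasurable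
      (.of_forall fun x => hC _)
  have hint2 : Integrable fun x => S ((x - l) * 2 ^ j * 2 ^ n0 + 1) * indInt k q x :=
    (integrable_indInt _ _).bdd_mul (hSm.comp (by fun_prop)).aestronglyMeasurable
      (.of_forall fun x => hC _)
  have hshift : coeffB S n0 j i k (q + 2 ^ r) =
      ∫ x, S ((x - l) * 2 ^ j * 2 ^ n0 + 1) * indInt k q x := by
    rw [coeffB, ← integral_add_right_eq_self _ ((2 ^ j * 2 ^ n0)⁻¹ : ℝ)]
    congr 1 with x
    congr 1
    · congr 1
      field_simp
      ring
    · rw [indInt_eq_ite, indInt_eq_ite]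
      have : (x + ((2:ℝ) ^ j * 2 ^ n0)⁻¹) / 2 ^ k = x / 2 ^ k + ((2 ^ r : ℤ) : ℝ) := by
        rw [hk, zpow_neg, zpow_natCast, pow_add, pow_add]
        push_cast
        field_simp
      rw [this, Int.floor_add_intCast]
      exact if_congr (by constructor <;> intro h <;> omega) rfl rfl
  rw [hshift, coeffB, coeffB, ← integral_sub hint1 hint2]
  congr 1 with x
  rw [hBS, sub_mul]

lemma coeffB_ne_zero_of_support (hS : ∀ t, t ∉ Set.Ico (0:ℝ) 1 → S t = 0) {n0 j i r : ℕ} {q : ℤ}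
    (h : coeffB S n0 j i (-(j + n0 + r : ℕ)) q ≠ 0) :
    2 * i * 2 ^ n0 * 2 ^ r ≤ q ∧ q < (2 * i * 2 ^ n0 + 1) * 2 ^ r := by
  by_contra hq
  refine h ?_
  have h2 : (2 * i : ℝ) * 2 ^ (-(j : ℤ)) * 2 ^ j = 2 * i := by
    rw [zpow_neg, zpow_natCast]; field_simp
  have (x : ℝ) : S ((x - (2 * i : ℝ) * 2 ^ (-(j : ℤ))) * 2 ^ j * 2 ^ n0) *
      indInt (-(j + n0 + r : ℕ)) q x = 0 := by
    by_cases hx : (x - (2 * i : ℝ) * 2 ^ (-(j : ℤ))) * 2 ^ j * 2 ^ n0 ∈ Set.Ico (0:ℝ) 1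
    swap
    · rw [hS _ hx, zero_mul]
    rw [indInt_eq_ite, if_neg, mul_zero]
    intro hfl
    apply hq
    rw [sub_mul, h2] at hx
    rw [zpow_neg, zpow_natCast, div_inv_eq_mul, pow_add, pow_add] at hfl
    have hr : (0:ℝ) < 2 ^ r := by positivity
    rw [← hfl, Int.le_floor, Int.floor_lt]
    push_cast
    constructor <;> nlinarith [hx.1, hx.2]
  simp only [coeffB, this, integral_zero]

/-- Over the even dyadic intervals of a finer scale the contributions of `B` cancel. -/
lemma sum_coeffB_eq_zero (hBS : ∀ t, B t = S t - S (t + 1)) (hSm : Measurable S)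
    (hSb : ∃ C, ∀ t, |S t| ≤ C) (hS : ∀ t, t ∉ Set.Ico (0:ℝ) 1 → S t = 0)
    {n0 j i : ℕ} (hj : 1 ≤ j) (hi : i < 2 ^ (j - 1)) {j' : ℕ} (hj' : j + n0 + 1 ≤ j') :
    ∑ m ∈ Finset.Ico (-2 ^ (j' - 1) : ℤ) (2 ^ (j' - 1)), coeffB B n0 j i (-j') (2 * m) = 0 := by
  obtain ⟨r, rfl⟩ : ∃ r, j' = j + n0 + (r + 1) := ⟨j' - (j + n0 + 1), by omega⟩
  have hT : j + n0 + (r + 1) - 1 = j + n0 + r := by omega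
  rw [hT]
  simp_rw [coeffB_eq_sub hBS hSm hSb]
  set s : ℤ → ℝ := fun m => coeffB S n0 j i (-(j + n0 + (r + 1) : ℕ)) (2 * m) with hs
  have hsh (m : ℤ) : coeffB S n0 j i (-(j + n0 + (r + 1) : ℕ)) (2 * m + 2 ^ (r + 1)) =
      s (m + 2 ^ r) := by
    simp only [hs]; congr 1; ring
  simp_rw [hsh]
  rw [Finset.sum_sub_distrib, Finset.sum_Ico_add' s, sub_eq_zero]
  have hs0 (m : ℤ) (hm : s m ≠ 0) : (2 * i * 2 ^ n0) * 2 ^ r ≤ m ∧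
      m < (2 * i * 2 ^ n0 + 1) * 2 ^ r := by
    have := coeffB_ne_zero_of_support hS hm
    rw [pow_succ] at this
    constructor <;> linarith [this.1, this.2]
  have hP : (1:ℤ) ≤ 2 ^ n0 := one_le_pow₀ (by norm_num)
  have hR : (0:ℤ) < 2 ^ r := by positivity
  have hj2 : (2:ℤ) * i + 2 ≤ 2 ^ j := by
    have h1 : i + 1 ≤ 2 ^ (j - 1) := hi
    have h3 : 2 ^ j = 2 * 2 ^ (j - 1) := by rw [← pow_succ']; congr 1; omega
    have : 2 * i + 2 ≤ 2 ^ j := by omega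
    exact_mod_cast this
  have hi0 : (0:ℤ) ≤ i := by positivity
  have hupper : (2 * i * 2 ^ n0 + 1) * 2 ^ r ≤ (2:ℤ) ^ (j + n0 + r) := by
    rw [pow_add, pow_add]
    gcongr
    nlinarith
  have hlower : (0:ℤ) ≤ (2 * i * 2 ^ n0) * 2 ^ r := by positivity
  have hbig : (2:ℤ) ^ r ≤ 2 ^ (j + n0 + r) := by
    exact pow_le_pow_right₀ (by norm_num) (by omega)
  have hsub (a b : ℤ) (ha : a ≤ 0) (hb : 2 ^ (j + n0 + r) ≤ b) : ∑ m ∈ Finset.Ico a b, s m =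
      ∑ m ∈ Finset.Ico ((2 * i * 2 ^ n0) * 2 ^ r : ℤ) ((2 * i * 2 ^ n0 + 1) * 2 ^ r), s m := by
    refine (Finset.sum_subset (Finset.Ico_subset_Ico (by linarith) (by linarith)) ?_).symm
    intro m _ hm
    by_contra h
    exact hm (Finset.mem_Ico.2 (hs0 m h))
  rw [hsub (-2 ^ (j + n0 + r)) (2 ^ (j + n0 + r)) (by linarith) le_rfl,
    hsub (-2 ^ (j + n0 + r) + 2 ^ r) (2 ^ (j + n0 + r) + 2 ^ r) (by linarith) (by linarith)]

/-- The squares `I × J` at the scales `2kn₀` with `I ⊆ [0,1)` and `J ⊆ [-1,1)` even. -/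
noncomputable def testCubes (n0 : ℕ) : Finset (DyadicCube 2) :=
  ((Finset.Icc 1 (2 ^ n0)).sigma fun k => Finset.range (2 ^ (2 * k * n0)) ×ˢ
    Finset.Ico (-2 ^ (2 * k * n0 - 1) : ℤ) (2 ^ (2 * k * n0 - 1))).image
      fun t => (-(2 * t.1 * n0 : ℕ), ![(t.2.1 : ℤ), 2 * t.2.2])

lemma sum_testCubes {n0 : ℕ} (hn0 : 1 ≤ n0) (g : DyadicCube 2 → ℝ) :
    ∑ R ∈ testCubes n0, g R = ∑ k ∈ Finset.Icc 1 (2 ^ n0), ∑ p ∈ Finset.range (2 ^ (2 * k * n0)),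
      ∑ m ∈ Finset.Ico (-2 ^ (2 * k * n0 - 1) : ℤ) (2 ^ (2 * k * n0 - 1)),
        g (-(2 * k * n0 : ℕ), ![(p : ℤ), 2 * m]) := by
  rw [testCubes, Finset.sum_image, Finset.sum_sigma]
  · simp_rw [Finset.sum_product]
  · rintro ⟨k, p, m⟩ _ ⟨k', p', m'⟩ _ h
    simp only [Prod.mk.injEq, neg_inj, Nat.cast_inj] at h
    have hk : k = k' := by
      have := Nat.eq_of_mul_eq_mul_right hn0 h.1
      omega
    have h0 := congrFun h.2 0
    have h1 := congrFun h.2 1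
    simp at h0 h1
    simp [hk, h0, h1]

lemma sum_cubeVol_testCubes {n0 : ℕ} (hn0 : 1 ≤ n0) :
    ∑ R ∈ testCubes n0, cubeVol 2 R = 2 ^ n0 := by
  rw [sum_testCubes hn0]
  have (k : ℕ) (hk : k ∈ Finset.Icc 1 (2 ^ n0)) :
      ∑ p ∈ Finset.range (2 ^ (2 * k * n0)),
      ∑ m ∈ Finset.Ico (-2 ^ (2 * k * n0 - 1) : ℤ) (2 ^ (2 * k * n0 - 1)),
        cubeVol 2 (-(2 * k * n0 : ℕ), ![(p : ℤ), 2 * m]) = 1 := by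
    have hj : 1 ≤ 2 * k * n0 := by
      have := (Finset.mem_Icc.1 hk).1
      nlinarith
    generalize 2 * k * n0 = j at hj
    obtain ⟨j, rfl⟩ : ∃ j', j = j' + 1 := ⟨j - 1, by omega⟩
    have hcard : ((2:ℤ) ^ j + 2 ^ j).toNat = 2 ^ (j + 1) := by
      have : (2:ℤ) ^ j + 2 ^ j = ((2 ^ (j + 1) : ℕ) : ℤ) := by
        push_cast; ring
      rw [this, Int.toNat_natCast]
    simp only [cubeVol_two, Finset.sum_const, Int.card_Ico, Finset.card_range, sub_neg_eq_add,
      add_tsub_cancel_right, hcard, nsmul_eq_mul, zpow_neg, zpow_natCast]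
    push_cast
    field_simp
  rw [Finset.sum_congr rfl this]
  simp

lemma sum_sum_coeffA (hA : ∀ t, t ∉ Set.Ico (0:ℝ) 1 → A t = 0) (j : ℕ) :
    ∑ i ∈ Finset.range (2 ^ j), ∑ p ∈ Finset.range (2 ^ j), coeffA A j i (-j) p =
      ∫ t, A t * haar0 t := by
  have (i : ℕ) (hi : i ∈ Finset.range (2 ^ j)) :
      ∑ p ∈ Finset.range (2 ^ j), coeffA A j i (-j) p =
        ((2:ℝ) ^ j)⁻¹ * ∫ t, A t * haar0 t := by
    simp_rw [coeffA_self hA, Nat.cast_inj]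
    rw [Finset.sum_ite_eq', if_pos hi]
  rw [Finset.sum_congr rfl this]
  simp

lemma sum_sum_coeffB (hBS : ∀ t, B t = S t - S (t + 1))
    (hS : ∀ t, t ∉ Set.Ico (0:ℝ) 1 → S t = 0) (n0 : ℕ) {j : ℕ} (hj : 1 ≤ j) :
    ∑ i ∈ Finset.range (2 ^ (j - 1)), ∑ m ∈ Finset.Ico (-2 ^ (j - 1) : ℤ) (2 ^ (j - 1)),
      coeffB B n0 j i (-j) (2 * m) = ((2:ℝ) ^ n0)⁻¹ * (∫ t, S t) / 2 := by
  have (i : ℕ) (hi : i ∈ Finset.range (2 ^ (j - 1))) :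
      ∑ m ∈ Finset.Ico (-2 ^ (j - 1) : ℤ) (2 ^ (j - 1)), coeffB B n0 j i (-j) (2 * m) =
        ((2:ℝ) ^ j * 2 ^ n0)⁻¹ * ∫ t, S t := by
    simp_rw [coeffB_self hBS hS]
    rw [Finset.sum_ite_eq', if_pos]
    rw [Finset.mem_range] at hi
    have h1 : (i:ℤ) < 2 ^ (j - 1) := by exact_mod_cast hi
    exact Finset.mem_Ico.2 ⟨by omega, h1⟩
  rw [Finset.sum_congr rfl this]
  obtain ⟨j, rfl⟩ : ∃ j', j = j' + 1 := ⟨j - 1, by omega⟩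
  simp only [Finset.sum_const, Finset.card_range, nsmul_eq_mul, add_tsub_cancel_right, pow_succ]
  push_cast
  field_simp

lemma sum_testCubes_integral_fTest (hAm : Measurable A) (hAb : ∃ C, ∀ t, |A t| ≤ C)
    (hA : ∀ t, t ∉ Set.Ico (0:ℝ) 1 → A t = 0) (hA0 : ∫ t, A t = 0)
    (hBm : Measurable B) (hBb : ∃ C, ∀ t, |B t| ≤ C)
    (hBS : ∀ t, B t = S t - S (t + 1)) (hSm : Measurable S)
    (hSb : ∃ C, ∀ t, |S t| ≤ C) (hS : ∀ t, t ∉ Set.Ico (0:ℝ) 1 → S t = 0)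
    {n0 : ℕ} (hn0 : 1 ≤ n0) :
    ∑ R ∈ testCubes n0, ∫ x, fTest A B n0 x * haarCube 2 (stdDir 2 0) R x =
      (∫ t, A t * haar0 t) * (∫ t, S t) / 2 := by
  rw [sum_testCubes hn0]
  have hpos {k : ℕ} (hk : k ∈ Finset.Icc 1 (2 ^ n0)) : 1 ≤ 2 * k * n0 := by
    have := (Finset.mem_Icc.1 hk).1
    nlinarith
  have key (k' : ℕ) (hk' : k' ∈ Finset.Icc 1 (2 ^ n0)) :
      ∑ p ∈ Finset.range (2 ^ (2 * k' * n0)),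
      ∑ m ∈ Finset.Ico (-2 ^ (2 * k' * n0 - 1) : ℤ) (2 ^ (2 * k' * n0 - 1)),
        ∫ x, fTest A B n0 x *
          haarCube 2 (stdDir 2 0) (-(2 * k' * n0 : ℕ), ![(p : ℤ), 2 * m]) x =
      (∫ t, A t * haar0 t) * (((2:ℝ) ^ n0)⁻¹ * (∫ t, S t) / 2) := by
    simp_rw [integral_fTest_mul_haarCube hAm hAb hBm hBb, ← Finset.sum_mul_sum]
    simp only [Matrix.cons_val_zero, Matrix.cons_val_one]
    conv_lhs =>
      enter [2, p]
      rw [Finset.sum_comm]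
    rw [Finset.sum_comm]
    simp_rw [← Finset.mul_sum, ← Finset.sum_mul]
    rw [Finset.sum_eq_single_of_mem k' hk']
    · congr 1
      · rw [Finset.sum_comm, sum_sum_coeffA hA]
      · rw [Finset.sum_comm, sum_sum_coeffB hBS hS n0 (hpos hk')]
    · intro k hk hne
      rcases lt_or_gt_of_ne hne with hlt | hlt
      · refine mul_eq_zero_of_right _ ?_
        rw [Finset.sum_comm]
        refine Finset.sum_eq_zero fun i hi => sum_coeffB_eq_zero hBS hSm hSb hS (hpos hk)
          (Finset.mem_range.1 hi) ?_
        nlinarith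
      · refine mul_eq_zero_of_left (Finset.sum_eq_zero fun p _ => Finset.sum_eq_zero fun i _ =>
          coeffA_eq_zero_of_lt hA hA0 ?_) _
        rw [neg_lt_neg_iff, Nat.cast_lt]
        exact Nat.mul_lt_mul_of_pos_right (by omega) hn0
  rw [Finset.sum_congr rfl key]
  simp
  field_simp

end Pairing

section Profiles

lemma eq_zero_of_support_subset_Icc {A : ℝ → ℝ} (hA : Continuous A)
    (hs : Function.support A ⊆ Set.Icc 0 1) {t : ℝ} (ht : t ∉ Set.Ico (0:ℝ) 1) : A t = 0 := by
  by_cases h1 : t = 1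
  · have hc : IsClosed {t | A t = 0} := isClosed_eq hA continuous_const
    have : Set.Ioi (1:ℝ) ⊆ {t | A t = 0} := fun t ht => by
      by_contra h
      exact absurd (hs h).2 (not_le.2 ht)
    have := hc.closure_subset_iff.2 this
    rw [closure_Ioi] at this
    exact this h1.ge
  · by_contra h
    exact ht ⟨(hs h).1, lt_of_le_of_ne (hs h).2 h1⟩

/-- A single arch of `sin (π t)`. -/
noncomputable def sinArch (t : ℝ) : ℝ :=
  if t ∈ Set.Ico (0:ℝ) 1 then Real.sin (Real.pi * t) else 0

lemma measurable_sinArch : Measurable sinArch :=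
  Measurable.ite measurableSet_Ico (by fun_prop) measurable_const

lemma abs_sinArch_le (t : ℝ) : |sinArch t| ≤ 1 := by
  unfold sinArch
  split_ifs
  · exact Real.abs_sin_le_one _
  · simp

lemma sinArch_eq_zero (t : ℝ) (ht : t ∉ Set.Ico (0:ℝ) 1) : sinArch t = 0 := if_neg ht

lemma integral_sinArch_pos : 0 < ∫ t, sinArch t := by
  have : sinArch = (Set.Ico (0:ℝ) 1).indicator fun t => Real.sin (Real.pi * t) := by
    ext t
    rw [sinArch, Set.indicator_apply]
  rw [this, integral_indicator measurableSet_Ico, integral_Ico_eq_integral_Ioc,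
    ← intervalIntegral.integral_of_le zero_le_one]
  refine intervalIntegral.intervalIntegral_pos_of_pos_on
    (Continuous.intervalIntegrable (by fun_prop) _ _) (fun t ht => ?_) one_pos
  exact Real.sin_pos_of_pos_of_lt_pi (by nlinarith [Real.pi_pos, ht.1])
    (by nlinarith [Real.pi_pos, ht.2])

lemma integral_sin_mul_haar0_pos :
    0 < ∫ t in Set.Ico (0:ℝ) 1, Real.sin (2 * Real.pi * t) * haar0 t := by
  have h (t : ℝ) (ht : t ∈ Set.Ico (0:ℝ) 1) :
      Real.sin (2 * Real.pi * t) * haar0 t = |Real.sin (2 * Real.pi * t)| := by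
    have hpi := Real.pi_pos
    rcases lt_or_ge t (1 / 2) with h | h
    · rw [haar0, Set.indicator_of_mem (Set.mem_Ico.2 ⟨ht.1, h⟩),
        Set.indicator_of_notMem (fun h' => by linarith [h'.1]), abs_of_nonneg, sub_zero, mul_one]
      exact Real.sin_nonneg_of_nonneg_of_le_pi (by nlinarith [ht.1]) (by nlinarith)
    · rw [haar0, Set.indicator_of_notMem (fun h' => by linarith [h'.2]),
        Set.indicator_of_mem (Set.mem_Ico.2 ⟨h, ht.2⟩), abs_of_nonpos]
      · ring
      · rw [← Real.sin_sub_two_pi]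
        exact Real.sin_nonpos_of_nonpos_of_neg_pi_le (by nlinarith [ht.2]) (by nlinarith)
  rw [setIntegral_congr_fun measurableSet_Ico h, integral_Ico_eq_integral_Ioc,
    ← intervalIntegral.integral_of_le zero_le_one]
  refine intervalIntegral.integral_pos zero_lt_one (by fun_prop) (fun _ _ => abs_nonneg _)
    ⟨1 / 4, by norm_num, ?_⟩
  rw [show 2 * Real.pi * (1 / 4) = Real.pi / 2 by ring, Real.sin_pi_div_two]
  norm_num

lemma integral_mul_haar0 (A : ℝ → ℝ) :
    ∫ t, A t * haar0 t = ∫ t in Set.Ico (0:ℝ) 1, A t * haar0 t := by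
  refine (setIntegral_eq_integral_of_forall_compl_eq_zero fun t ht => ?_).symm
  rw [haar0, Set.indicator_of_notMem, Set.indicator_of_notMem, sub_zero, mul_zero]
  · exact fun h => ht ⟨by linarith [h.1], h.2⟩
  · exact fun h => ht ⟨h.1, by linarith [h.2]⟩

variable {B : ℝ → ℝ}

lemma sine_eq_sinArch_sub
    (hB : B = fun t => if t ∈ Set.Icc (-1 : ℝ) 1 then Real.sin (Real.pi * t) else 0) (t : ℝ) :
    B t = sinArch t - sinArch (t + 1) := by
  have h1 : Real.sin (Real.pi * (t + 1)) = -Real.sin (Real.pi * t) := by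
    rw [mul_add, mul_one, Real.sin_add_pi]
  simp only [hB, sinArch, Set.mem_Icc, Set.mem_Ico, h1]
  by_cases h : t = 1
  · subst h
    norm_num
  split_ifs with h2 h3 h4 h4 h3 h4 h4 <;> first
    | simp; done
    | (exfalso; grind)

end Profiles

section Norms

/-- On a set of finite measure containing the support, a larger exponent gives a larger norm, up
to a constant. -/
lemma eLpNorm_two_le_of_support_subset {v : (Fin 2 → ℝ) → ℝ} (hv : Measurable v)
    (hs : Function.support v ⊆ Set.Icc (-1 : Fin 2 → ℝ) 1) {p : ℝ} (hp : 2 ≤ p) :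
    eLpNorm v 2 volume ≤ eLpNorm v (ENNReal.ofReal p) volume * 4 := by
  have hvol : (volume.restrict (Set.Icc (-1 : Fin 2 → ℝ) 1)) Set.univ = 4 := by
    rw [Measure.restrict_apply_univ, Real.volume_Icc_pi]
    norm_num
  rw [← eLpNorm_restrict_eq_of_support_subset (p := 2) (μ := volume) hs,
    ← eLpNorm_restrict_eq_of_support_subset (p := ENNReal.ofReal p) (μ := volume) hs]
  have h2p : (2 : ℝ≥0∞) ≤ ENNReal.ofReal p := by
    rw [ENNReal.le_ofReal_iff_toReal_le (by norm_num) (by linarith)]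
    simpa using hp
  refine (eLpNorm_le_eLpNorm_mul_rpow_measure_univ h2p hv.aestronglyMeasurable).trans ?_
  rw [hvol, ENNReal.toReal_ofReal (by linarith)]
  gcongr
  refine (ENNReal.rpow_le_rpow_of_exponent_le (by norm_num) (z := 1) ?_).trans_eq
    (ENNReal.rpow_one _)
  have : 0 < 1 / p := by positivity
  norm_num
  linarith [this, one_div p]

lemma ofReal_mul_rpow_le {c : ℝ} {N : ℝ≥0∞} {n0 : ℕ}
    (h : ENNReal.ofReal c ≤ N * ENNReal.ofReal (((2:ℝ) ^ n0) ^ ((1:ℝ) / 2))) :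
    ENNReal.ofReal (c * ((2:ℝ) ^ (-(n0 : ℤ))) ^ ((1:ℝ) / 2)) ≤ N := by
  have hpos : (0:ℝ) < ((2:ℝ) ^ n0) ^ ((1:ℝ) / 2) := by positivity
  rw [zpow_neg, zpow_natCast, Real.inv_rpow (by positivity), ← div_eq_mul_inv,
    ENNReal.ofReal_div_of_pos hpos]
  exact ENNReal.div_le_of_le_mul h

end Norms

theorem fTest_haar_projection_lower_bound
    (A : ℝ → ℝ) (B : ℝ → ℝ)
    (hB : B = fun t => if t ∈ Set.Icc (-1 : ℝ) 1 then Real.sin (Real.pi * t) else 0)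
    (hA_smooth : ContDiff ℝ (⊤ : ℕ∞) A)
    (hA_supp : Function.support A ⊆ Set.Icc 0 1) (hA_int : ∫ t, A t = 0)
    (hA_match : ∫ t in Set.Ico (0:ℝ) 1, A t * haar0 t =
      ∫ t in Set.Ico (0:ℝ) 1, Real.sin (2 * Real.pi * t) * haar0 t) :
    (∀ n0 : ℕ, 1 ≤ n0 →
      Function.support (haarProj 2 (stdDir 2 0) (fTest A B n0)) ⊆
        Set.Icc (-1 : Fin 2 → ℝ) 1) ∧
    (∃ c : ℝ, 0 < c ∧ ∀ n0 : ℕ, 1 ≤ n0 →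
      ENNReal.ofReal (c * ((2:ℝ) ^ (-(n0 : ℤ))) ^ ((1:ℝ)/2)) ≤
        eLpNorm (haarProj 2 (stdDir 2 0) (fTest A B n0)) 2 volume) ∧
    (∀ p : ℝ, 2 ≤ p → ∃ cp : ℝ, 0 < cp ∧ ∀ n0 : ℕ, 1 ≤ n0 →
      ENNReal.ofReal (cp * ((2:ℝ) ^ (-(n0 : ℤ))) ^ ((1:ℝ)/2)) ≤
        eLpNorm (haarProj 2 (stdDir 2 0) (fTest A B n0)) (ENNReal.ofReal p) volume) := by
  have hAc := hA_smooth.continuous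
  have hA (t : ℝ) (ht : t ∉ Set.Ico (0:ℝ) 1) : A t = 0 :=
    eq_zero_of_support_subset_Icc hAc hA_supp ht
  have hAcs : HasCompactSupport A := HasCompactSupport.of_support_subset_isCompact isCompact_Icc
    hA_supp
  have hAb : ∃ C, ∀ t, |A t| ≤ C := hAcs.exists_bound_of_continuous hAc
  obtain ⟨L, hL⟩ := ContDiff.lipschitzWith_of_hasCompactSupport hAcs hA_smooth (by simp)
  have hBS := sine_eq_sinArch_sub hB
  have hSb : ∃ C, ∀ t, |sinArch t| ≤ C := ⟨1, abs_sinArch_le⟩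
  have hBm : Measurable B := by
    rw [hB]
    exact Measurable.ite measurableSet_Icc (by fun_prop) measurable_const
  have hB1 (t : ℝ) : |B t| ≤ 1 := by
    rw [hB]
    dsimp only
    split_ifs
    · exact Real.abs_sin_le_one _
    · simp
  have hB0 (t : ℝ) (ht : t ∉ Set.Ico (-1:ℝ) 1) : B t = 0 := by
    rw [hBS, sinArch_eq_zero, sinArch_eq_zero, sub_zero]
    · exact fun h => ht ⟨by linarith [h.1], by linarith [h.2]⟩
    · exact fun h => ht ⟨by linarith [h.1], h.2⟩
  have hsupp (n0 : ℕ) (hn0 : 1 ≤ n0) :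
      Function.support (haarProj 2 (stdDir 2 0) (fTest A B n0)) ⊆ Set.Icc (-1 : Fin 2 → ℝ) 1 :=
    support_haarProj_fTest hAc.measurable hA hA_int hAb hBm hB0 ⟨1, hB1⟩ hn0
  obtain ⟨c, hc, hL2⟩ : ∃ c : ℝ, 0 < c ∧ ∀ n0 : ℕ, 1 ≤ n0 →
      ENNReal.ofReal (c * ((2:ℝ) ^ (-(n0 : ℤ))) ^ ((1:ℝ)/2)) ≤
        eLpNorm (haarProj 2 (stdDir 2 0) (fTest A B n0)) 2 volume := by
    have hc : 0 < (∫ t, A t * haar0 t) * (∫ t, sinArch t) / 2 := by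
      rw [integral_mul_haar0, hA_match]
      exact half_pos (mul_pos integral_sin_mul_haar0_pos integral_sinArch_pos)
    refine ⟨_, hc, fun n0 hn0 => ofReal_mul_rpow_le ?_⟩
    rw [← sum_testCubes_integral_fTest hAc.measurable hAb hA hA_int hBm ⟨1, hB1⟩ hBS
      measurable_sinArch hSb sinArch_eq_zero hn0, ← sum_cubeVol_testCubes hn0]
    exact ofReal_sum_coeff_le
      (summable_integral_fTest_mul_haarCube hA hA_int hL hAb hBm hB0 hB1 hn0) _
  refine ⟨hsupp, ⟨c, hc, hL2⟩, fun p hp => ⟨c / 4, by positivity, fun n0 hn0 => ?_⟩⟩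
  have h := (hL2 n0 hn0).trans
    (eLpNorm_two_le_of_support_subset (measurable_haarProj _) (hsupp n0 hn0) hp)
  rw [div_mul_eq_mul_div, ENNReal.ofReal_div_of_pos (by norm_num)]
  refine ENNReal.div_le_of_le_mul ?_
  simpa using h
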